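/- A fuzzy metric space (X,M,*) is Lebesgue if and only if every subset of X that is closed and discrete in (X,τ_M) is fuzzy uniformly discrete in (X,M,*). -/

import Mathlib

open Filter Topology Set

/-- A fuzzy metric space in the sense of George and Veeramani: a continuous
t-norm `star` on `[0,1]` together with a fuzzy set `M` on `X × X × (0,∞)`. -/
structure FuzzyMetric (X : Type*) where
  M : X → X → ℝ → ℝ
  star : ℝ → ℝ → ℝ
  star_mem : ∀ a ∈ Set.Icc (0:ℝ) 1, ∀ b ∈ Set.Icc (0:ℝ) 1, star a b ∈ Set.Icc (0:ℝ) 1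
  star_comm : ∀ a ∈ Set.Icc (0:ℝ) 1, ∀ b ∈ Set.Icc (0:ℝ) 1, star a b = star b a
  star_assoc : ∀ a ∈ Set.Icc (0:ℝ) 1, ∀ b ∈ Set.Icc (0:ℝ) 1, ∀ c ∈ Set.Icc (0:ℝ) 1,
    star (star a b) c = star a (star b c)
  star_one : ∀ a ∈ Set.Icc (0:ℝ) 1, star a 1 = a
  star_mono : ∀ a b c d : ℝ, a ∈ Set.Icc (0:ℝ) 1 → b ∈ Set.Icc (0:ℝ) 1 →
    c ∈ Set.Icc (0:ℝ) 1 → d ∈ Set.Icc (0:ℝ) 1 → a ≤ b → c ≤ d → star a c ≤ star b d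
  star_continuous : ContinuousOn (fun p : ℝ × ℝ => star p.1 p.2)
    (Set.Icc (0:ℝ) 1 ×ˢ Set.Icc (0:ℝ) 1)
  M_pos : ∀ x y t, 0 < t → 0 < M x y t
  M_le_one : ∀ x y t, 0 < t → M x y t ≤ 1
  M_eq_one_iff : ∀ x y t, 0 < t → (M x y t = 1 ↔ x = y)
  M_symm : ∀ x y t, 0 < t → M x y t = M y x t
  M_triangle : ∀ x y z t s, 0 < t → 0 < s → star (M x y t) (M y z s) ≤ M x z (t + s)
  M_continuousOn : ∀ x y, ContinuousOn (M x y) (Set.Ioi (0:ℝ))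

namespace FuzzyMetric

variable {X : Type*}

/-- The open ball `B(x,r,t)`. -/
def ball (F : FuzzyMetric X) (x : X) (r t : ℝ) : Set X := {y | 1 - r < F.M x y t}

/-- The topology `τ_M` induced by the fuzzy metric (the balls form a base for it). -/
def topology (F : FuzzyMetric X) : TopologicalSpace X :=
  TopologicalSpace.generateFrom
    {s | ∃ x : X, ∃ r t : ℝ, r ∈ Set.Ioo (0:ℝ) 1 ∧ 0 < t ∧ s = F.ball x r t}

/-- `f : X → ℝ` is `ℝ`-uniformly continuous. -/
def RUniformlyContinuous (F : FuzzyMetric X) (f : X → ℝ) : Prop :=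
  ∀ ε > (0:ℝ), ∃ r ∈ Set.Ioo (0:ℝ) 1, ∃ s > (0:ℝ),
    ∀ x y : X, 1 - r < F.M x y s → |f x - f y| < ε

/-- The Lebesgue property: every open cover is refined by the family of balls of
some fixed radius `r` and parameter `t`. -/
def Lebesgue (F : FuzzyMetric X) : Prop :=
  ∀ 𝒢 : Set (Set X), (∀ G ∈ 𝒢, F.topology.IsOpen G) → ⋃₀ 𝒢 = Set.univ →
    ∃ r ∈ Set.Ioo (0:ℝ) 1, ∃ t > (0:ℝ), ∀ x : X, ∃ G ∈ 𝒢, F.ball x r t ⊆ G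

/-- A set `A ⊆ X` is fuzzy uniformly discrete. -/
def UniformlyDiscrete (F : FuzzyMetric X) (A : Set X) : Prop :=
  ∃ r ∈ Set.Ioo (0:ℝ) 1, ∃ s > (0:ℝ), ∀ x ∈ A, ∀ y ∈ A, x ≠ y → F.M x y s < 1 - r

/-- The set `X'` of accumulation points of `(X, τ_M)`. -/
def derivedSet (F : FuzzyMetric X) : Set X :=
  {x | ∀ U : Set X, F.topology.IsOpen U → x ∈ U → ∃ y ∈ U, y ≠ x}

/-- A sequence is Cauchy in the fuzzy metric. -/
def IsCauchy (F : FuzzyMetric X) (u : ℕ → X) : Prop :=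
  ∀ ε ∈ Set.Ioo (0:ℝ) 1, ∀ t > (0:ℝ), ∃ k : ℕ, ∀ m ≥ k, ∀ n ≥ k, 1 - ε < F.M (u m) (u n) t

/-- Sequential compactness: every sequence has a convergent subsequence. -/
def SeqCompact (F : FuzzyMetric X) : Prop :=
  ∀ u : ℕ → X, ∃ x : X, ∃ φ : ℕ → ℕ, StrictMono φ ∧
    Filter.Tendsto (u ∘ φ) Filter.atTop (@nhds X F.topology x)

end FuzzyMetric

namespace FuzzyMetric

variable {X : Type*} (F : FuzzyMetric X)

theorem M_mem_Icc (x y : X) {t : ℝ} (ht : 0 < t) : F.M x y t ∈ Icc (0 : ℝ) 1 :=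
  ⟨(F.M_pos x y t ht).le, F.M_le_one x y t ht⟩

theorem M_mono (x y : X) {s t : ℝ} (hs : 0 < s) (hst : s ≤ t) : F.M x y s ≤ F.M x y t := by
  rcases hst.eq_or_lt with rfl | h
  · rfl
  · have h1 := F.M_triangle x y y s (t - s) hs (by linarith)
    rwa [(F.M_eq_one_iff y y (t - s) (by linarith)).2 rfl, F.star_one _ (F.M_mem_Icc x y hs),
      add_sub_cancel] at h1

theorem ball_subset_ball (x : X) {r r' t t' : ℝ} (ht : 0 < t) (hr : r ≤ r') (htt : t ≤ t') :
    F.ball x r t ⊆ F.ball x r' t' := fun y (hy : 1 - r < F.M x y t) =>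
  show 1 - r' < F.M x y t' by linarith [F.M_mono x y ht htt]

theorem mem_ball_self (x : X) {r t : ℝ} (hr : 0 < r) (ht : 0 < t) : x ∈ F.ball x r t := by
  show 1 - r < F.M x x t
  rw [(F.M_eq_one_iff x x t ht).2 rfl]
  linarith

theorem mem_ball_comm {x y : X} {r t : ℝ} (ht : 0 < t) : y ∈ F.ball x r t ↔ x ∈ F.ball y r t := by
  show 1 - r < F.M x y t ↔ 1 - r < F.M y x t
  rw [F.M_symm x y t ht]

/-- Continuity of the t-norm at `(a, 1)`, in the form of a lower bound. -/
theorem exists_lt_star {a q : ℝ} (ha : a ∈ Icc (0 : ℝ) 1) (hq : q < a) :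
    ∃ e > 0, ∀ a' ∈ Icc (0 : ℝ) 1, ∀ b ∈ Icc (0 : ℝ) 1, a - e < a' → 1 - e < b →
      q < F.star a' b := by
  have hone : (1 : ℝ) ∈ Icc (0 : ℝ) 1 := ⟨zero_le_one, le_rfl⟩
  have hc := F.star_continuous (a, 1) ⟨ha, hone⟩
  obtain ⟨e, he, h⟩ := Metric.continuousWithinAt_iff.1 hc (a - q) (by linarith)
  refine ⟨e, he, fun a' ha' b hb h1 h2 => ?_⟩
  have hmin : min a' a ∈ Icc (0 : ℝ) 1 := ⟨le_min ha'.1 ha.1, (min_le_right _ _).trans ha.2⟩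
  have h3 := @h (min a' a, b) ⟨hmin, hb⟩ (by
    rw [Prod.dist_eq, Real.dist_eq, Real.dist_eq]
    refine max_lt (abs_lt.2 ⟨?_, ?_⟩) (abs_lt.2 ⟨?_, ?_⟩)
    · linarith [lt_min h1 (by linarith : a - e < a)]
    · linarith [min_le_right a' a]
    · linarith
    · linarith [hb.2])
  simp only [Real.dist_eq, F.star_one a ha] at h3
  linarith [(abs_lt.1 h3).1, F.star_mono _ _ b b hmin ha' hb hb (min_le_left a' a) le_rfl]

/-- The `n`-th member of the standard countable base of neighbourhoods of `x`. -/
def stdBall (n : ℕ) (x : X) : Set X := F.ball x (1 / (n + 2)) (1 / (n + 2))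

theorem one_div_add_two_pos (n : ℕ) : (0 : ℝ) < 1 / (n + 2) := by positivity

theorem one_div_add_two_mem (n : ℕ) : (1 / (n + 2) : ℝ) ∈ Ioo (0 : ℝ) 1 := by
  refine ⟨one_div_add_two_pos n, ?_⟩
  rw [div_lt_one (by positivity)]
  linarith [n.cast_nonneg (α := ℝ)]

theorem exists_one_div_add_two_lt {e : ℝ} (he : 0 < e) : ∃ n : ℕ, (1 / (n + 2) : ℝ) < e := by
  obtain ⟨n, hn⟩ := exists_nat_one_div_lt he
  exact ⟨n, (one_div_le_one_div_of_le (by positivity) (by linarith)).trans_lt hn⟩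

theorem isOpen_stdBall (n : ℕ) (x : X) : F.topology.IsOpen (F.stdBall n x) :=
  .basic _ ⟨x, _, _, one_div_add_two_mem n, one_div_add_two_pos n, rfl⟩

theorem mem_stdBall_self (n : ℕ) (x : X) : x ∈ F.stdBall n x :=
  F.mem_ball_self x (one_div_add_two_pos n) (one_div_add_two_pos n)

theorem mem_stdBall_comm {n : ℕ} {x y : X} : y ∈ F.stdBall n x ↔ x ∈ F.stdBall n y :=
  F.mem_ball_comm (one_div_add_two_pos n)

theorem stdBall_antitone (x : X) : Antitone fun n => F.stdBall n x := fun m n hmn => by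
  have : (1 / (n + 2) : ℝ) ≤ 1 / (m + 2) :=
    one_div_le_one_div_of_le (by positivity) (by gcongr)
  exact F.ball_subset_ball x (one_div_add_two_pos n) this this

theorem exists_stdBall_subset_ball {r t : ℝ} (hr : 0 < r) (ht : 0 < t) :
    ∃ n, ∀ x, F.stdBall n x ⊆ F.ball x r t := by
  obtain ⟨n, hn⟩ := exists_one_div_add_two_lt (lt_min hr ht)
  exact ⟨n, fun x => F.ball_subset_ball x (one_div_add_two_pos n)
    (hn.le.trans (min_le_left _ _)) (hn.le.trans (min_le_right _ _))⟩

theorem exists_stdBall_comp (n : ℕ) :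
    ∃ m, ∀ x y z, y ∈ F.stdBall m x → z ∈ F.stdBall m y → z ∈ F.stdBall n x := by
  have hn := one_div_add_two_pos n
  obtain ⟨e, he, h⟩ := F.exists_lt_star (a := 1) (q := 1 - 1 / (n + 2)) ⟨zero_le_one, le_rfl⟩
    (by linarith)
  have ht : (0 : ℝ) < 1 / (n + 2) / 2 := by positivity
  obtain ⟨m, hm⟩ := F.exists_stdBall_subset_ball he ht
  refine ⟨m, fun x y z hy hz => (h _ (F.M_mem_Icc x y ht) _ (F.M_mem_Icc y z ht)
    (hm x hy) (hm y hz)).trans_le ?_⟩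
  simpa only [add_halves] using F.M_triangle x y z _ _ ht ht

theorem exists_stdBall_subset_of_mem_ball {x y : X} {r t : ℝ} (ht : 0 < t)
    (hy : y ∈ F.ball x r t) : ∃ n, F.stdBall n y ⊆ F.ball x r t := by
  obtain ⟨e, he, h⟩ := F.exists_lt_star (F.M_mem_Icc x y ht) hy
  obtain ⟨d, hd, hM⟩ := Metric.continuousAt_iff.1
    ((F.M_continuousOn x y).continuousAt (Ioi_mem_nhds ht)) e he
  obtain ⟨s, hs, hs'⟩ := exists_between (lt_min hd ht)
  have hts : 0 < t - s := by linarith [min_le_right d t]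
  have h1 := hM (x := t - s) (by
    rw [Real.dist_eq, abs_lt]
    constructor <;> linarith [min_le_left d t])
  rw [Real.dist_eq, abs_lt] at h1
  obtain ⟨n, hn⟩ := F.exists_stdBall_subset_ball he hs
  refine ⟨n, fun z hz => (h _ (F.M_mem_Icc x y hts) _ (F.M_mem_Icc y z hs) (by linarith)
    (hn y hz)).trans_le ?_⟩
  simpa only [sub_add_cancel] using F.M_triangle x y z _ _ hts hs

theorem exists_stdBall_subset_of_isOpen {G : Set X} (hG : F.topology.IsOpen G) :
    ∀ x ∈ G, ∃ n, F.stdBall n x ⊆ G := by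
  induction hG with
  | basic s hs =>
    obtain ⟨x, r, t, -, ht, rfl⟩ := hs
    exact fun y hy => F.exists_stdBall_subset_of_mem_ball ht hy
  | univ => exact fun x _ => ⟨0, subset_univ _⟩
  | inter s t _ _ ihs iht =>
    rintro x ⟨hxs, hxt⟩
    obtain ⟨m, hm⟩ := ihs x hxs
    obtain ⟨n, hn⟩ := iht x hxt
    exact ⟨max m n, subset_inter ((F.stdBall_antitone x (le_max_left m n)).trans hm)
      ((F.stdBall_antitone x (le_max_right m n)).trans hn)⟩
  | sUnion S _ ih =>
    rintro x ⟨s, hs, hx⟩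
    obtain ⟨n, hn⟩ := ih s hs x hx
    exact ⟨n, hn.trans (subset_sUnion_of_mem hs)⟩

theorem exists_notMem_stdBall {x y : X} (hxy : x ≠ y) : ∃ n, y ∉ F.stdBall n x := by
  have h1 : F.M x y 1 < 1 := (F.M_le_one x y 1 one_pos).lt_of_ne
    fun h => hxy ((F.M_eq_one_iff x y 1 one_pos).1 h)
  obtain ⟨n, hn⟩ := F.exists_stdBall_subset_ball (sub_pos.2 h1) one_pos
  refine ⟨n, fun h => ?_⟩
  have h2 : 1 - (1 - F.M x y 1) < F.M x y 1 := hn x h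
  linarith

theorem exists_stdBall_inter_subset_singleton {A : Set X} {p : X} {N : ℕ}
    (hA : (F.stdBall N p ∩ A).Finite) : ∃ n, F.stdBall n p ∩ A ⊆ {p} := by
  have h : ∀ q ∈ F.stdBall N p ∩ A, ∀ᶠ n in atTop, q ∈ F.stdBall n p → q = p := by
    intro q _
    by_cases hqp : p = q
    · exact .of_forall fun _ _ => hqp.symm
    · obtain ⟨n, hn⟩ := F.exists_notMem_stdBall hqp
      filter_upwards [eventually_ge_atTop n] with m hm hq
      exact absurd (F.stdBall_antitone p hm hq) hn
  obtain ⟨n, hn, hNn⟩ := (((eventually_all_finite hA).2 h).and (eventually_ge_atTop N)).exists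
  exact ⟨n, fun q hq => hn q ⟨F.stdBall_antitone p hNn hq.1, hq.2⟩ hq.1⟩

theorem isClosed_of_stdBall_inter_subset_singleton {A : Set X}
    (hA : ∀ p, ∃ n, F.stdBall n p ∩ A ⊆ {p}) : @IsClosed X F.topology A := by
  let := F.topology
  refine ⟨isOpen_iff_forall_mem_open.2 fun p hp => ?_⟩
  obtain ⟨n, hn⟩ := hA p
  refine ⟨F.stdBall n p, fun q hq hqA => hp ?_, F.isOpen_stdBall n p, F.mem_stdBall_self n p⟩
  exact (hn ⟨hq, hqA⟩ : q = p) ▸ hqA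

theorem Lebesgue.uniformlyDiscrete {F : FuzzyMetric X} (hF : F.Lebesgue) {A : Set X}
    (hA : @IsClosed X F.topology A)
    (hd : ∀ a ∈ A, ∃ U : Set X, F.topology.IsOpen U ∧ U ∩ A = {a}) : F.UniformlyDiscrete A := by
  obtain ⟨r, hr, t, ht, h⟩ := hF (insert Aᶜ {U | F.topology.IsOpen U ∧ ∃ a, U ∩ A = {a}})
    (by
      rintro G (rfl | hG)
      · exact hA.isOpen_compl
      · exact hG.1)
    (by
      refine eq_univ_of_forall fun x => ?_
      by_cases hx : x ∈ A
      · obtain ⟨U, hU, hUA⟩ := hd x hx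
        exact ⟨U, .inr ⟨hU, x, hUA⟩, (hUA.ge rfl).1⟩
      · exact ⟨Aᶜ, .inl rfl, hx⟩)
  refine ⟨r / 2, ⟨by linarith [hr.1], by linarith [hr.1, hr.2]⟩, t, ht,
    fun x hx y hy hxy => ?_⟩
  by_contra! hM
  have hyB : y ∈ F.ball x r t := show 1 - r < F.M x y t by linarith [hr.1]
  have hxB : x ∈ F.ball x r t := F.mem_ball_self x hr.1 ht
  obtain ⟨G, rfl | ⟨-, a, ha⟩, hG⟩ := h x
  · exact hG hxB hx
  · exact hxy ((ha.le ⟨hG hxB, hx⟩ : x = a).trans (ha.le ⟨hG hyB, hy⟩ : y = a).symm)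

/-- Sequences witnessing the failure of the Lebesgue property; neither has a cluster point. -/
theorem exists_seq_of_not_lebesgue (hF : ¬ F.Lebesgue) :
    ∃ x y : ℕ → X, (∀ k, x k ≠ y k) ∧ (∀ k, y k ∈ F.stdBall k (x k)) ∧
      ∀ p, ∃ N, ∀ k ≥ N, x k ∉ F.stdBall N p ∧ y k ∉ F.stdBall N p := by
  simp only [Lebesgue] at hF
  push Not at hF
  obtain ⟨𝒢, ho, hcov, h⟩ := hF
  choose x hx using fun n : ℕ =>
    h _ (one_div_add_two_mem n) _ (one_div_add_two_pos n)
  have hcov' : ∀ p, ∃ G ∈ 𝒢, p ∈ G := fun p => hcov.ge (mem_univ p)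
  have hy : ∀ k, ∃ y, x k ≠ y ∧ y ∈ F.stdBall k (x k) := by
    intro k
    obtain ⟨G, hG, hxG⟩ := hcov' (x k)
    obtain ⟨y, hy, hyG⟩ := not_subset.1 (hx k G hG)
    exact ⟨y, fun e => hyG (e ▸ hxG), hy⟩
  choose y hne hy using hy
  refine ⟨x, y, hne, hy, fun p => ?_⟩
  obtain ⟨G, hG, hpG⟩ := hcov' p
  obtain ⟨n, hn⟩ := F.exists_stdBall_subset_of_isOpen (ho G hG) p hpG
  obtain ⟨m, hm⟩ := F.exists_stdBall_comp n
  obtain ⟨l, hl⟩ := F.exists_stdBall_comp m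
  have hxm : ∀ k ≥ m, x k ∉ F.stdBall m p := fun k hk hxk =>
    hx k G hG fun z hz => hn (hm p (x k) z hxk (F.stdBall_antitone (x k) hk hz))
  refine ⟨max m l, fun k hk => ⟨fun hxk => ?_, fun hyk => ?_⟩⟩
  · exact hxm k ((le_max_left m l).trans hk) (F.stdBall_antitone p (le_max_left m l) hxk)
  · exact hxm k ((le_max_left m l).trans hk) (hl p (y k) (x k)
      (F.stdBall_antitone p (le_max_right m l) hyk)
      (F.stdBall_antitone (y k) ((le_max_right m l).trans hk) (F.mem_stdBall_comm.1 (hy k))))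

theorem lebesgue_of_uniformlyDiscrete
    (h : ∀ A : Set X, @IsClosed X F.topology A →
      (∀ a ∈ A, ∃ U : Set X, F.topology.IsOpen U ∧ U ∩ A = {a}) → F.UniformlyDiscrete A) :
    F.Lebesgue := by
  by_contra hF
  obtain ⟨x, y, hne, hxy, hfar⟩ := F.exists_seq_of_not_lebesgue hF
  have hA : ∀ p, ∃ n, F.stdBall n p ∩ (range x ∪ range y) ⊆ {p} := by
    intro p
    obtain ⟨N, hN⟩ := hfar p
    refine F.exists_stdBall_inter_subset_singleton (N := N)
      ((((finite_Iio N).image x).union ((finite_Iio N).image y)).subset ?_)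
    rintro _ ⟨hq, ⟨k, rfl⟩ | ⟨k, rfl⟩⟩
    · exact .inl ⟨k, not_le.1 fun hk => (hN k hk).1 hq, rfl⟩
    · exact .inr ⟨k, not_le.1 fun hk => (hN k hk).2 hq, rfl⟩
  obtain ⟨r, hr, s, hs, hd⟩ := h _ (F.isClosed_of_stdBall_inter_subset_singleton hA)
    fun a ha => by
      obtain ⟨n, hn⟩ := hA a
      exact ⟨F.stdBall n a, F.isOpen_stdBall n a,
        hn.antisymm (singleton_subset_iff.2 ⟨F.mem_stdBall_self n a, ha⟩)⟩
  obtain ⟨n, hn⟩ := F.exists_stdBall_subset_ball hr.1 hs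
  exact lt_asymm (hn (x n) (hxy n)) (hd _ (.inl ⟨n, rfl⟩) _ (.inr ⟨n, rfl⟩) (hne n))

end FuzzyMetric

/-- A fuzzy metric space is Lebesgue iff every closed and discrete subset of `(X, τ_M)`
is fuzzy uniformly discrete in `(X,M,*)`. -/
theorem lebesgue_iff_closed_discrete_uniformlyDiscrete {X : Type*} [Nonempty X]
    (F : FuzzyMetric X) :
    F.Lebesgue ↔
      ∀ A : Set X, @IsClosed X F.topology A →
        (∀ a ∈ A, ∃ U : Set X, F.topology.IsOpen U ∧ U ∩ A = {a}) →
        F.UniformlyDiscrete A := by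
  exact ⟨fun hF A hA hd => hF.uniformlyDiscrete hA hd, F.lebesgue_of_uniformlyDiscrete⟩
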